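/- In the group S₄ × ℤ/2 = Equiv.Perm (Fin 4) × ZMod 2, the elements g₁ = ((12), 0̄), g₂ = ((1234), 1̄), g₃ = ((432), 1̄) have orders 2, 4, 6 respectively, satisfy g₁ · g₂ · g₃ = 1 (permutations multiplied by composition, applying the right factor first), and generate S₄ × ℤ/2. (These data realize the ramification type (2, 4, 6) of the covering C₁ → ℙ¹ with Galois group S₄ × ℤ/2.) -/

import Mathlib

namespace S4Z2

abbrev G : Type := Equiv.Perm (Fin 4) × Multiplicative (ZMod 2)

/-- ((12), 0̄), on points {1,2,3,4} realized on Fin 4 = {0,1,2,3}. -/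
def g₁ : G := (c[0, 1], Multiplicative.ofAdd 0)
/-- ((1234), 1̄). -/
def g₂ : G := (c[0, 1, 2, 3], Multiplicative.ofAdd 1)
/-- ((432), 1̄). -/
def g₃ : G := (c[1, 3, 2], Multiplicative.ofAdd 1)

end S4Z2

namespace S4Z2

theorem map_fst_closure_eq_top :
    (Subgroup.closure {g₁, g₂, g₃}).map (MonoidHom.fst _ _) = ⊤ := by
  have hcycle : (c[0, 1, 2, 3] : Equiv.Perm (Fin 4)).IsCycle :=
    List.isCycle_formPerm (by decide) (by decide)
  rw [MonoidHom.map_closure, eq_top_iff,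
    ← Equiv.Perm.closure_cycle_adjacent_swap hcycle (by decide) 0, Subgroup.closure_le]
  rintro σ (rfl | rfl)
  · exact Subgroup.subset_closure ⟨g₂, by simp, rfl⟩
  · exact Subgroup.subset_closure ⟨g₁, by simp, by decide⟩

theorem one_prod_mem_closure (z : Multiplicative (ZMod 2)) :
    ((1, z) : G) ∈ Subgroup.closure {g₁, g₂, g₃} := by
  have hz : ∀ z : Multiplicative (ZMod 2), ((1, z) : G) = g₃ ^ (3 * z.toAdd.val) := by decide
  rw [hz]
  exact pow_mem (Subgroup.subset_closure (by simp)) _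

theorem closure_eq_top : Subgroup.closure {g₁, g₂, g₃} = (⊤ : Subgroup G) := by
  rw [Subgroup.eq_top_iff']
  rintro ⟨σ, z⟩
  obtain ⟨⟨τ, w⟩, hw, rfl⟩ : σ ∈ (Subgroup.closure {g₁, g₂, g₃}).map (MonoidHom.fst _ _) :=
    map_fst_closure_eq_top ▸ Subgroup.mem_top σ
  simpa using mul_mem hw (one_prod_mem_closure (w⁻¹ * z))

end S4Z2

open S4Z2 in
/-- The tuple (((12),0̄), ((1234),1̄), ((432),1̄)) of elements of S₄ × ℤ/2 has orders
(2,4,6), product 1, and generates S₄ × ℤ/2: it realizes the ramification type (2,4,6)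
of the covering C₁ → ℙ¹ with group S₄ × ℤ/2. -/
theorem S4Z2_ramification_data_C1 :
    orderOf g₁ = 2 ∧ orderOf g₂ = 4 ∧ orderOf g₃ = 6 ∧
    g₁ * g₂ * g₃ = 1 ∧
    Subgroup.closure {g₁, g₂, g₃} = (⊤ : Subgroup G) := by
  refine ⟨?_, ?_, ?_, by decide, closure_eq_top⟩
  · exact (orderOf_eq_iff (by norm_num)).2 ⟨by decide, by decide⟩
  · exact (orderOf_eq_iff (by norm_num)).2 ⟨by decide, by decide⟩
  · exact (orderOf_eq_iff (by norm_num)).2 ⟨by decide, by decide⟩
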